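/- arXiv:2210.07963 — 2 statements merged into one kernel-verified Lean document; each statement's English description precedes it below -/
import Mathlib

section
/- Lower bound on the joint exponent: For every probability distribution P_X on 𝒳 and every R > 0, ρ_joint(P_X,R) ≥ min_{s∈𝒮} min( inf_{P̂ ∈ P'_{Y|X}(P_X,R,s)} γ₁(P̂,R,s), inf_{P̂ ∈ P''_{Y|X}(P_X,R,s)} γ₂(P̂,R,s) ). -/
open scoped BigOperators ENNReal NNReal

namespace JCAS

variable {𝒳 𝒴 𝒵 𝒮 : Type}

/-- `p` is a probability mass function on the finite alphabet `𝒳`. -/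
def IsPMF [Fintype 𝒳] (p : 𝒳 → ℝ) : Prop :=
  (∀ x, 0 ≤ p x) ∧ ∑ x, p x = 1

/-- `V` is a channel (conditional probability distribution) from `𝒳` to `𝒴`. -/
def IsChannel [Fintype 𝒳] [Fintype 𝒴] (V : 𝒳 → 𝒴 → ℝ) : Prop :=
  ∀ x, IsPMF (V x)

/-- Mutual information `I(P, V)` (natural logarithm), with `0·log(0/a) = 0`. -/
noncomputable def mutualInfo [Fintype 𝒳] [Fintype 𝒴] (P : 𝒳 → ℝ) (V : 𝒳 → 𝒴 → ℝ) : ℝ :=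
  ∑ x, ∑ y, P x * V x y * Real.log (V x y / ∑ x', P x' * V x' y)

/-- `a ^ ℓ` with the convention `0 ^ ℓ = 0` (in particular `0 ^ 0 = 0`). -/
noncomputable def pow0 (a ℓ : ℝ) : ℝ := if a = 0 then 0 else a ^ ℓ

/-- `Σ_z W(z)^ℓ · W'(z)^{1-ℓ}`. -/
noncomputable def chernoffSum [Fintype 𝒵] (W W' : 𝒵 → ℝ) (ℓ : ℝ) : ℝ :=
  ∑ z, pow0 (W z) ℓ * pow0 (W' z) (1 - ℓ)

/-- Chernoff information between the channels `W` and `W'` under input distribution `P`: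
`max_{ℓ∈[0,1]} −Σ_x P(x) log( Σ_z W(z|x)^ℓ W'(z|x)^{1−ℓ} )`. -/
noncomputable def chernoffPair [Fintype 𝒳] [Fintype 𝒵] (P : 𝒳 → ℝ) (W W' : 𝒳 → 𝒵 → ℝ) : ℝ :=
  sSup ((fun ℓ => -∑ x, P x * Real.log (chernoffSum (W x) (W' x) ℓ)) '' Set.Icc (0 : ℝ) 1)

/-- `ψ_s(P) = min_{s' ≠ s} (Chernoff information between `W_s` and `W_{s'}` under `P`)`. -/
noncomputable def psi [Fintype 𝒳] [Fintype 𝒵] (WZ : 𝒮 → 𝒳 → 𝒵 → ℝ) (P : 𝒳 → ℝ) (s : 𝒮) : ℝ :=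
  sInf ((fun s' => chernoffPair P (WZ s) (WZ s')) '' {s' : 𝒮 | s' ≠ s})

/-- Chernoff detection-error exponent `φ(P) = min_s ψ_s(P)`. -/
noncomputable def phi [Fintype 𝒳] [Fintype 𝒵] (WZ : 𝒮 → 𝒳 → 𝒵 → ℝ) (P : 𝒳 → ℝ) : ℝ :=
  ⨅ s, psi WZ P s

/-- Standing assumption: for all `s ≠ s'` the best Chernoff information is positive. -/
def StandingAssumption [Fintype 𝒳] [Fintype 𝒵] (WZ : 𝒮 → 𝒳 → 𝒵 → ℝ) : Prop :=
  ∀ s s' : 𝒮, s ≠ s' →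
    0 < sSup ((fun P => chernoffPair P (WZ s) (WZ s')) '' {P : 𝒳 → ℝ | IsPMF P})

/-- Empirical distribution (type) of a sequence `x ∈ 𝒳ⁿ`. -/
noncomputable def empDist [Fintype 𝒳] [DecidableEq 𝒳] {n : ℕ} (x : Fin n → 𝒳) (a : 𝒳) : ℝ :=
  (Finset.univ.filter (fun i => x i = a)).card / n

/-- Conditional entropy `H(Q | P)` (natural logarithm). -/
noncomputable def condH [Fintype 𝒳] [Fintype 𝒴] (P : 𝒳 → ℝ) (Q : 𝒳 → 𝒴 → ℝ) : ℝ :=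
  -∑ x, ∑ y, P x * Q x y * Real.log (Q x y)

/-- Output distribution `(P ∘ Q)(y) = Σ_x P(x) Q(y|x)`. -/
noncomputable def outDist [Fintype 𝒳] (P : 𝒳 → ℝ) (Q : 𝒳 → 𝒴 → ℝ) (y : 𝒴) : ℝ :=
  ∑ x, P x * Q x y

/-- Shannon entropy of a distribution on `𝒴` (natural logarithm). -/
noncomputable def ent [Fintype 𝒴] (Q : 𝒴 → ℝ) : ℝ := -∑ y, Q y * Real.log (Q y)

open Classical in
/-- Conditional relative entropy `D(Q ‖ V | P)`, equal to `+∞` when absolute continuity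
fails. -/
noncomputable def condKL [Fintype 𝒳] [Fintype 𝒴] (P : 𝒳 → ℝ) (Q V : 𝒳 → 𝒴 → ℝ) : ℝ≥0∞ :=
  if ∀ x y, P x * Q x y ≠ 0 → V x y ≠ 0 then
    ENNReal.ofReal (∑ x, ∑ y, P x * Q x y * Real.log (Q x y / V x y))
  else ⊤

/-- Successive-scheme exponent
`ρ_succ(P,R) = min_s inf_{Q} [ D(Q‖W_s|P) + |I(P,Q) − R|⁺ ]`, in `ℝ≥0∞`. -/
noncomputable def rhoSucc [Fintype 𝒳] [Fintype 𝒴] (W : 𝒮 → 𝒳 → 𝒴 → ℝ)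
    (P : 𝒳 → ℝ) (R : ℝ) : ℝ≥0∞ :=
  ⨅ s, ⨅ Q ∈ {Q : 𝒳 → 𝒴 → ℝ | IsChannel Q},
    condKL P Q (W s) + ENNReal.ofReal (mutualInfo P Q - R)

/-- `β(Q,P,R,s)`: infimum of `D(Q''‖W_s|P) + H(Q''|P)` over channels `Q''` with
`I(P,Q'') < R` and `P∘Q'' = P∘Q` (`+∞` if no such channel exists). -/
noncomputable def beta [Fintype 𝒳] [Fintype 𝒴] (W : 𝒮 → 𝒳 → 𝒴 → ℝ) (Q : 𝒳 → 𝒴 → ℝ)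
    (P : 𝒳 → ℝ) (R : ℝ) (s : 𝒮) : ℝ≥0∞ :=
  ⨅ Q'' ∈ {Q'' : 𝒳 → 𝒴 → ℝ | IsChannel Q'' ∧ mutualInfo P Q'' < R ∧
      ∀ y, outDist P Q'' y = outDist P Q y},
    condKL P Q'' (W s) + ENNReal.ofReal (condH P Q'')

/-- The set `P_{s,s'}(Q,P,R)` of conditional distributions. -/
def PSet [Fintype 𝒳] [Fintype 𝒴] (W : 𝒮 → 𝒳 → 𝒴 → ℝ) (Q : 𝒳 → 𝒴 → ℝ)
    (P : 𝒳 → ℝ) (R : ℝ) (s s' : 𝒮) : Set (𝒳 → 𝒴 → ℝ) :=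
  {Q' | IsChannel Q' ∧
    condKL P Q' (W s') + ENNReal.ofReal (condH P Q')
      ≤ min (beta W Q P R s) (condKL P Q (W s) + ENNReal.ofReal (condH P Q)) ∧
    ∀ y, outDist P Q' y = outDist P Q y}

/-- Joint decoding-and-detection exponent `ρ_joint(P,R)`, in `ℝ≥0∞`; truncated
subtraction implements `|·−R|⁺` and an infimum over an empty set is `+∞`. -/
noncomputable def rhoJoint [Fintype 𝒳] [Fintype 𝒴] (W : 𝒮 → 𝒳 → 𝒴 → ℝ)
    (P : 𝒳 → ℝ) (R : ℝ) : ℝ≥0∞ :=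
  ⨅ s, ⨅ Q ∈ {Q : 𝒳 → 𝒴 → ℝ | IsChannel Q},
    condKL P Q (W s) +
      ((⨅ s' ∈ {s' : 𝒮 | s' ≠ s}, ⨅ Q' ∈ PSet W Q P R s s',
          ENNReal.ofReal (mutualInfo P Q')) - ENNReal.ofReal R)

/-- `γ₁(Q,R,s) = D(Q‖W_s|P) + |I(P,Q) − R|⁺`. -/
noncomputable def gamma1 [Fintype 𝒳] [Fintype 𝒴] (W : 𝒮 → 𝒳 → 𝒴 → ℝ) (P : 𝒳 → ℝ)
    (Q : 𝒳 → 𝒴 → ℝ) (R : ℝ) (s : 𝒮) : ℝ≥0∞ :=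
  condKL P Q (W s) + ENNReal.ofReal (mutualInfo P Q - R)

/-- `γ₂(Q,R,s) = D(Q‖W_s|P) + | D(Q‖W_s|P) + H(P∘Q) − β(Q,P,R,s) − R |⁺`. -/
noncomputable def gamma2 [Fintype 𝒳] [Fintype 𝒴] (W : 𝒮 → 𝒳 → 𝒴 → ℝ) (P : 𝒳 → ℝ)
    (Q : 𝒳 → 𝒴 → ℝ) (R : ℝ) (s : 𝒮) : ℝ≥0∞ :=
  condKL P Q (W s) +
    ((condKL P Q (W s) + ENNReal.ofReal (ent (outDist P Q)) - beta W Q P R s)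
      - ENNReal.ofReal R)

/-- `P'_{Y|X}(P,R,s)`: channels `Q` with `max_{s''} β(Q,P,R,s'') ≥ D(Q‖W_s|P) + H(Q|P)`. -/
def PsetPrime [Fintype 𝒳] [Fintype 𝒴] [Fintype 𝒮] (W : 𝒮 → 𝒳 → 𝒴 → ℝ) (P : 𝒳 → ℝ)
    (R : ℝ) (s : 𝒮) : Set (𝒳 → 𝒴 → ℝ) :=
  {Q | IsChannel Q ∧
    condKL P Q (W s) + ENNReal.ofReal (condH P Q) ≤ ⨆ s'', beta W Q P R s''}

/-- `P''_{Y|X}(P,R,s)`: channels `Q` with `max_{s''} β(Q,P,R,s'') < D(Q‖W_s|P) + H(Q|P)`. -/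
def PsetDoublePrime [Fintype 𝒳] [Fintype 𝒴] [Fintype 𝒮] (W : 𝒮 → 𝒳 → 𝒴 → ℝ) (P : 𝒳 → ℝ)
    (R : ℝ) (s : 𝒮) : Set (𝒳 → 𝒴 → ℝ) :=
  {Q | IsChannel Q ∧
    (⨆ s'', beta W Q P R s'') < condKL P Q (W s) + ENNReal.ofReal (condH P Q)}

theorem mutualInfo_eq_ent_sub_condH [Fintype 𝒳] [Fintype 𝒴] {P : 𝒳 → ℝ} (hP : ∀ x, 0 ≤ P x)
    {V : 𝒳 → 𝒴 → ℝ} (hV : ∀ x y, 0 ≤ V x y) :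
    mutualInfo P V = ent (outDist P V) - condH P V := by
  have h : ∀ x y, P x * V x y * Real.log (V x y / ∑ x', P x' * V x' y)
      = P x * V x y * Real.log (V x y) - P x * V x y * Real.log (outDist P V y) := by
    intro x y
    rcases eq_or_ne (P x * V x y) 0 with h0 | h0
    · simp [h0]
    · have hpos : 0 < ∑ x', P x' * V x' y :=
        Finset.sum_pos' (fun x' _ => mul_nonneg (hP x') (hV x' y))
          ⟨x, Finset.mem_univ x, lt_of_le_of_ne (mul_nonneg (hP x) (hV x y)) h0.symm⟩
      rw [Real.log_div (right_ne_zero_of_mul h0) hpos.ne', mul_sub, outDist]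
  have hout : ∑ x, ∑ y, P x * V x y * Real.log (outDist P V y)
      = ∑ y, outDist P V y * Real.log (outDist P V y) := by
    rw [Finset.sum_comm]
    exact Finset.sum_congr rfl fun y _ => (Finset.sum_mul _ _ _).symm
  simp only [mutualInfo, h, Finset.sum_sub_distrib, hout, ent, condH]
  ring

theorem beta_congr [Fintype 𝒳] [Fintype 𝒴] (W : 𝒮 → 𝒳 → 𝒴 → ℝ) {Q Q' : 𝒳 → 𝒴 → ℝ}
    {P : 𝒳 → ℝ} (h : outDist P Q' = outDist P Q) (R : ℝ) (s : 𝒮) :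
    beta W Q' P R s = beta W Q P R s := by
  simp only [beta, h]

theorem add_iInf_sub {ι : Sort*} (f : ι → ℝ≥0∞) (a : ℝ≥0∞) {b : ℝ≥0∞} (hb : b ≠ ⊤) :
    a + ((⨅ i, f i) - b) = ⨅ i, (a + (f i - b)) :=
  Monotone.map_iInf_of_continuousAt (f := fun x => a + (x - b))
    ((continuous_const.add (ENNReal.continuous_sub_right b)).continuousAt)
    (fun _ _ h => by dsimp only; gcongr) (by simp [ENNReal.top_sub hb])

theorem mem_PsetPrime_of_mem_PSet [Fintype 𝒳] [Fintype 𝒴] [Fintype 𝒮] {W : 𝒮 → 𝒳 → 𝒴 → ℝ}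
    {P : 𝒳 → ℝ} {R : ℝ} {s s' : 𝒮} {Q Q' : 𝒳 → 𝒴 → ℝ} (h : Q' ∈ PSet W Q P R s s') :
    Q' ∈ PsetPrime W P R s' := by
  refine ⟨h.1, (h.2.1.trans (min_le_left _ _)).trans ?_⟩
  rw [← beta_congr W (funext h.2.2)]
  exact le_iSup (beta W Q' P R) s

/-- Each pair consisting of a channel `Q` and a competitor `Q'` is dominated by one of
`γ₁(Q', s')`, `γ₁(Q, s)` and `γ₂(Q, s)`. -/
theorem iInf_min_gamma_le_of_mem_PSet [Fintype 𝒳] [Fintype 𝒴] [Fintype 𝒮]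
    {W : 𝒮 → 𝒳 → 𝒴 → ℝ} {P : 𝒳 → ℝ} (hP : IsPMF P) {R : ℝ} (hR : 0 ≤ R) {s s' : 𝒮}
    {Q Q' : 𝒳 → 𝒴 → ℝ} (hQ : IsChannel Q) (h : Q' ∈ PSet W Q P R s s') :
    (⨅ s, min (⨅ Q ∈ PsetPrime W P R s, gamma1 W P Q R s)
              (⨅ Q ∈ PsetDoublePrime W P R s, gamma2 W P Q R s))
      ≤ condKL P Q (W s) + (ENNReal.ofReal (mutualInfo P Q') - ENNReal.ofReal R) := by
  have hI := mutualInfo_eq_ent_sub_condH hP.1 (fun x y => (hQ x).1 y)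
  have hI' := mutualInfo_eq_ent_sub_condH hP.1 (fun x y => (h.1 x).1 y)
  rw [funext h.2.2] at hI'
  have hle := h.2.1
  rw [le_min_iff] at hle
  rcases le_or_gt (condKL P Q' (W s')) (condKL P Q (W s)) with hD | hD
  · refine (iInf_le _ s').trans ((min_le_left _ _).trans
      ((iInf₂_le Q' (mem_PsetPrime_of_mem_PSet h)).trans ?_))
    rw [gamma1, ENNReal.ofReal_sub _ hR]
    gcongr
  · refine (iInf_le _ s).trans ?_
    rcases le_or_gt (condKL P Q (W s) + ENNReal.ofReal (condH P Q))
      (⨆ s'', beta W Q P R s'') with hβ | hβ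
    · refine (min_le_left _ _).trans ((iInf₂_le Q ⟨hQ, hβ⟩).trans ?_)
      have hH : condH P Q' < condH P Q := by
        by_contra! hH
        exact (ENNReal.add_lt_add_of_lt_of_le ENNReal.ofReal_ne_top hD
          (ENNReal.ofReal_le_ofReal hH)).not_ge hle.2
      rw [gamma1, ENNReal.ofReal_sub _ hR]
      gcongr
      linarith
    · refine (min_le_right _ _).trans ((iInf₂_le Q ⟨hQ, hβ⟩).trans ?_)
      rw [gamma2]
      gcongr
      rw [tsub_le_iff_right]
      have hent : ENNReal.ofReal (ent (outDist P Q))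
          ≤ ENNReal.ofReal (mutualInfo P Q') + ENNReal.ofReal (condH P Q') := by
        refine le_trans (ENNReal.ofReal_le_ofReal ?_) ENNReal.ofReal_add_le
        linarith
      calc condKL P Q (W s) + ENNReal.ofReal (ent (outDist P Q))
          ≤ condKL P Q' (W s')
            + (ENNReal.ofReal (mutualInfo P Q') + ENNReal.ofReal (condH P Q')) :=
            add_le_add hD.le hent
        _ = ENNReal.ofReal (mutualInfo P Q')
            + (condKL P Q' (W s') + ENNReal.ofReal (condH P Q')) := by ring
        _ ≤ ENNReal.ofReal (mutualInfo P Q') + beta W Q P R s := by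
            gcongr
            exact hle.1

/-- part of Corollary 8 of the paper: lower bound on the joint
exponent in terms of `γ₁` and `γ₂`. -/
theorem rhoJoint_lowerBound
    [Fintype 𝒳] [Fintype 𝒴] [Fintype 𝒮]
    (W : 𝒮 → 𝒳 → 𝒴 → ℝ) (hW : ∀ s, IsChannel (W s))
    (P : 𝒳 → ℝ) (hP : IsPMF P) (R : ℝ) (hR : 0 < R) :
    (⨅ s, min (⨅ Q ∈ PsetPrime W P R s, gamma1 W P Q R s)
              (⨅ Q ∈ PsetDoublePrime W P R s, gamma2 W P Q R s))
      ≤ rhoJoint W P R := by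
  refine le_iInf fun s => le_iInf₂ fun Q hQ => ?_
  simp only [add_iInf_sub _ _ ENNReal.ofReal_ne_top]
  exact le_iInf₂ fun s' _ => le_iInf₂ fun Q' hQ' =>
    iInf_min_gamma_le_of_mem_PSet hP hR.le hQ hQ'

end JCAS
end

section
/- Maximum-likelihood state detection with a known constant-composition input (achievability part of the paper's Lemma): Let x = (x₁,…,x_n) ∈ 𝒳ⁿ have empirical distribution (type) P_X, let s ∈ 𝒮, and let Z₁,…,Z_n be independent with Z_i ~ W_{Z|X,s}(·|x_i). Then the probability that there exists s' ≠ s with ∏_{i=1}ⁿ W_{Z|X,s'}(Z_i|x_i) ≥ ∏_{i=1}ⁿ W_{Z|X,s}(Z_i|x_i) is at most (|𝒮|−1)·exp(−n·ψ_s(P_X)); in particular, the error probability of the maximum likelihood state estimator (which errs only on this event) is at most (|𝒮|−1)·exp(−n·ψ_s(P_X)) ≤ (|𝒮|−1)·exp(−n·φ(P_X)). -/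
open scoped BigOperators ENNReal NNReal

namespace JCAS

variable {𝒳 𝒴 𝒵 𝒮 : Type}

lemma pow0_nonneg {a : ℝ} (ha : 0 ≤ a) (ℓ : ℝ) : 0 ≤ pow0 a ℓ := by
  unfold pow0
  split_ifs
  · exact le_rfl
  · exact Real.rpow_nonneg ha ℓ

lemma prod_pow0 {ι : Type*} (t : Finset ι) {f : ι → ℝ} (hf : ∀ i ∈ t, 0 ≤ f i) (ℓ : ℝ) :
    ∏ i ∈ t, pow0 (f i) ℓ = pow0 (∏ i ∈ t, f i) ℓ := by
  by_cases h : ∃ i ∈ t, f i = 0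
  · obtain ⟨i, hi, h0⟩ := h
    rw [Finset.prod_eq_zero hi h0, Finset.prod_eq_zero hi (by simp [pow0, h0])]
    simp [pow0]
  · push Not at h
    rw [pow0, if_neg (Finset.prod_ne_zero_iff.mpr h), ← Real.finsetProd_rpow t f hf]
    exact Finset.prod_congr rfl fun i hi => if_neg (h i hi)

lemma le_pow0_mul_pow0 {a b ℓ : ℝ} (ha : 0 ≤ a) (hab : a ≤ b) (hℓ : ℓ ≤ 1) :
    a ≤ pow0 a ℓ * pow0 b (1 - ℓ) := by
  rcases ha.eq_or_lt with rfl | hpos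
  · exact mul_nonneg (pow0_nonneg le_rfl _) (pow0_nonneg hab _)
  · rw [pow0, pow0, if_neg hpos.ne', if_neg (hpos.trans_le hab).ne']
    calc a = a ^ ℓ * a ^ (1 - ℓ) := by rw [← Real.rpow_add hpos]; simp
      _ ≤ a ^ ℓ * b ^ (1 - ℓ) := by
        gcongr

lemma chernoffSum_nonneg [Fintype 𝒵] {W W' : 𝒵 → ℝ} (hW : ∀ z, 0 ≤ W z) (hW' : ∀ z, 0 ≤ W' z)
    (ℓ : ℝ) : 0 ≤ chernoffSum W W' ℓ :=
  Finset.sum_nonneg fun z _ => mul_nonneg (pow0_nonneg (hW z) _) (pow0_nonneg (hW' z) _)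

lemma sum_comp_eq_mul_sum_empDist [Fintype 𝒳] [DecidableEq 𝒳] {n : ℕ} (hn : 0 < n)
    (x : Fin n → 𝒳) (g : 𝒳 → ℝ) : ∑ i, g (x i) = n * ∑ a, empDist x a * g a := by
  have hn' : (n : ℝ) ≠ 0 := by exact_mod_cast hn.ne'
  rw [← Finset.sum_fiberwise Finset.univ x, Finset.mul_sum]
  refine Finset.sum_congr rfl fun a _ => ?_
  rw [Finset.sum_congr rfl (g := fun _ => g a)
    (fun i hi => by rw [(Finset.mem_filter.mp hi).2]), Finset.sum_const, nsmul_eq_mul, empDist]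
  field_simp

lemma prod_le_exp_sum_log {ι : Type*} (t : Finset ι) {f : ι → ℝ} (hf : ∀ i ∈ t, 0 ≤ f i) :
    ∏ i ∈ t, f i ≤ Real.exp (∑ i ∈ t, Real.log (f i)) := by
  rw [Real.exp_sum]
  exact Finset.prod_le_prod hf fun i _ => Real.le_exp_log (f i)

/-- For memoryless channels with a fixed input word, the probability of a likelihood comparison
error between two states is at most the product of the letterwise Chernoff sums. -/
lemma sum_likelihood_le_prod_chernoffSum [Fintype 𝒵] {n : ℕ} {V V' : Fin n → 𝒵 → ℝ}
    (hV : ∀ i z, 0 ≤ V i z) (hV' : ∀ i z, 0 ≤ V' i z) {ℓ : ℝ} (hℓ : ℓ ≤ 1) :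
    (∑ z : Fin n → 𝒵, if ∏ i, V i (z i) ≤ ∏ i, V' i (z i) then ∏ i, V i (z i) else 0)
      ≤ ∏ i, chernoffSum (V i) (V' i) ℓ := by
  classical
  simp only [chernoffSum]
  rw [Finset.prod_univ_sum, Fintype.piFinset_univ]
  refine Finset.sum_le_sum fun z _ => ?_
  split_ifs with h
  · rw [Finset.prod_mul_distrib, prod_pow0 _ fun i _ => hV i (z i),
      prod_pow0 _ fun i _ => hV' i (z i)]
    exact le_pow0_mul_pow0 (Finset.prod_nonneg fun i _ => hV i (z i)) h hℓ
  · exact Finset.prod_nonneg fun i _ =>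
      mul_nonneg (pow0_nonneg (hV i _) _) (pow0_nonneg (hV' i _) _)

/-- Chernoff bound for the pairwise likelihood comparison error under a constant-composition
input. -/
lemma sum_likelihood_le_exp_chernoffPair [Fintype 𝒳] [Fintype 𝒵] [DecidableEq 𝒳]
    {W W' : 𝒳 → 𝒵 → ℝ} (hW : ∀ a z, 0 ≤ W a z) (hW' : ∀ a z, 0 ≤ W' a z)
    {n : ℕ} (hn : 0 < n) (x : Fin n → 𝒳) :
    (∑ z : Fin n → 𝒵,
        if ∏ i, W (x i) (z i) ≤ ∏ i, W' (x i) (z i) then ∏ i, W (x i) (z i) else 0)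
      ≤ Real.exp (-(n : ℝ) * chernoffPair (empDist x) W W') := by
  set p := ∑ z : Fin n → 𝒵,
    if ∏ i, W (x i) (z i) ≤ ∏ i, W' (x i) (z i) then ∏ i, W (x i) (z i) else 0
  rcases le_or_gt p 0 with h0 | hpos
  · exact h0.trans (Real.exp_pos _).le
  have hn' : (0 : ℝ) < n := by exact_mod_cast hn
  rw [← Real.log_le_iff_le_exp hpos]
  suffices h : chernoffPair (empDist x) W W' ≤ -Real.log p / n by
    rw [le_div_iff₀ hn'] at h
    linarith
  refine csSup_le (Set.Nonempty.image _ ⟨0, by simp⟩) ?_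
  rintro _ ⟨ℓ, hℓ, rfl⟩
  have hle : p ≤ Real.exp (∑ i, Real.log (chernoffSum (W (x i)) (W' (x i)) ℓ)) :=
    (sum_likelihood_le_prod_chernoffSum (fun i => hW (x i)) (fun i => hW' (x i)) hℓ.2).trans
      (prod_le_exp_sum_log _ fun i _ => chernoffSum_nonneg (hW _) (hW' _) ℓ)
  rw [← Real.log_le_iff_le_exp hpos,
    sum_comp_eq_mul_sum_empDist hn x fun a => Real.log (chernoffSum (W a) (W' a) ℓ)] at hle
  rw [le_div_iff₀ hn']
  linarith

open Classical in
/-- achievability part of Lemma 9 of the paper: maximum-likelihood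
state detection with a known constant-composition input. -/
theorem ml_state_detection
    [Fintype 𝒳] [Fintype 𝒵] [Fintype 𝒮] [DecidableEq 𝒳]
    (WZ : 𝒮 → 𝒳 → 𝒵 → ℝ) (hW : ∀ s, IsChannel (WZ s))
    (n : ℕ) (hn : 0 < n) (x : Fin n → 𝒳) (P : 𝒳 → ℝ)
    (htype : ∀ a, empDist x a = P a) (s : 𝒮) :
    (∑ z : Fin n → 𝒵,
        if ∃ s' : 𝒮, s' ≠ s ∧ (∏ i, WZ s (x i) (z i)) ≤ ∏ i, WZ s' (x i) (z i)
        then ∏ i, WZ s (x i) (z i) else 0)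
      ≤ ((Fintype.card 𝒮 : ℝ) - 1) * Real.exp (-(n : ℝ) * psi WZ P s) ∧
    ((Fintype.card 𝒮 : ℝ) - 1) * Real.exp (-(n : ℝ) * psi WZ P s)
      ≤ ((Fintype.card 𝒮 : ℝ) - 1) * Real.exp (-(n : ℝ) * phi WZ P) := by
  have hnn : ∀ t a z, 0 ≤ WZ t a z := fun t a z => (hW t a).1 z
  have hcard : (0 : ℝ) ≤ (Fintype.card 𝒮 : ℝ) - 1 := by
    have : 0 < Fintype.card 𝒮 := Fintype.card_pos_iff.mpr ⟨s⟩
    rw [sub_nonneg]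
    exact_mod_cast this
  obtain rfl : empDist x = P := funext htype
  constructor
  · have hunion : (∑ z : Fin n → 𝒵,
        if ∃ s' : 𝒮, s' ≠ s ∧ (∏ i, WZ s (x i) (z i)) ≤ ∏ i, WZ s' (x i) (z i)
        then ∏ i, WZ s (x i) (z i) else 0)
        ≤ ∑ s' ∈ Finset.univ.erase s, ∑ z : Fin n → 𝒵,
          if ∏ i, WZ s (x i) (z i) ≤ ∏ i, WZ s' (x i) (z i)
          then ∏ i, WZ s (x i) (z i) else 0 := by
      rw [Finset.sum_comm]
      refine Finset.sum_le_sum fun z _ => ?_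
      have hterm : ∀ s' ∈ Finset.univ.erase s,
          0 ≤ if ∏ i, WZ s (x i) (z i) ≤ ∏ i, WZ s' (x i) (z i)
            then ∏ i, WZ s (x i) (z i) else 0 := by
        intro s' _
        split_ifs
        · exact Finset.prod_nonneg fun i _ => hnn s (x i) (z i)
        · exact le_rfl
      split_ifs with h
      · obtain ⟨s', hne, hle⟩ := h
        refine le_trans (le_of_eq ?_) (Finset.single_le_sum hterm (a := s') (by simp [hne]))
        rw [if_pos hle]
      · exact Finset.sum_nonneg hterm
    refine hunion.trans ?_
    calc _ ≤ ∑ _s' ∈ Finset.univ.erase s, Real.exp (-(n : ℝ) * psi WZ (empDist x) s) := by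
          refine Finset.sum_le_sum fun s' hs' => ?_
          refine (sum_likelihood_le_exp_chernoffPair (hnn s) (hnn s') hn x).trans ?_
          have hpsi : psi WZ (empDist x) s ≤ chernoffPair (empDist x) (WZ s) (WZ s') :=
            csInf_le (Set.toFinite _).bddBelow ⟨s', Finset.ne_of_mem_erase hs', rfl⟩
          refine Real.exp_le_exp.mpr (mul_le_mul_of_nonpos_left hpsi ?_)
          simp
      _ = _ := by
          rw [Finset.sum_const, nsmul_eq_mul, Finset.card_erase_of_mem (Finset.mem_univ s),
            Finset.card_univ, Nat.cast_pred (Fintype.card_pos_iff.mpr ⟨s⟩)]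
  · have hphi : phi WZ (empDist x) ≤ psi WZ (empDist x) s :=
      ciInf_le (Set.finite_range _).bddBelow s
    refine mul_le_mul_of_nonneg_left (Real.exp_le_exp.mpr ?_) hcard
    exact mul_le_mul_of_nonpos_left hphi (by simp)

end JCAS
end
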